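/- Let n ≥ 1 and define Φ_n*(t) = (1/(3n²)) Σ_{j ∈ ℍ_n*} c_j^{(n)} φ_j(t) for t ∈ ℝ³_H. Then for all k, j ∈ ℍ_n*, Φ_n*((k−j)/n) = 1 if k/n ≡ j/n (mod 3) and Φ_n*((k−j)/n) = 0 otherwise. Consequently, for every function f : ℝ³_H → ℂ the function I_n* f(t) = Σ_{j ∈ ℍ_n*} f(j/n) Φ_n*(t − j/n) satisfies: I_n* f(j/n) = f(j/n) for every interior point j ∈ ℍ_n°, and I_n* f(j/n) = Σ_{k ∈ S_j} f(k/n) for every boundary point j ∈ ℍ_n* \ ℍ_n°, where S_j = {k ∈ ℍ_n* : k/n ≡ j/n (mod 3)}. -/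

import Mathlib

open MeasureTheory
open scoped Real Classical

noncomputable section

/-- `φ_j(t) = exp(2πi (j₁t₁ + j₂t₂ + j₃t₃)/3)` for `j ∈ ℤ³`, `t ∈ ℝ³`. -/
def phi (j : ℤ × ℤ × ℤ) (t : ℝ × ℝ × ℝ) : ℂ :=
  Complex.exp (2 * (Real.pi : ℂ) * Complex.I *
    ((j.1 : ℂ) * (t.1 : ℂ) + (j.2.1 : ℂ) * (t.2.1 : ℂ) + (j.2.2 : ℂ) * (t.2.2 : ℂ)) / 3)

/-- `ℍ_n = {j ∈ ℍ : -n ≤ j₁ < n, -n ≤ j₂ < n, -n ≤ -j₃ < n}`. -/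
def Hn (n : ℕ) : Set (ℤ × ℤ × ℤ) :=
  {j | j.1 + j.2.1 + j.2.2 = 0 ∧ -(n : ℤ) ≤ j.1 ∧ j.1 < n ∧
       -(n : ℤ) ≤ j.2.1 ∧ j.2.1 < n ∧ -(n : ℤ) ≤ -j.2.2 ∧ -j.2.2 < n}

/-- `ℍ_n* = {j ∈ ℍ : -n ≤ j₁, j₂, j₃ ≤ n}`. -/
def Hstar (n : ℕ) : Set (ℤ × ℤ × ℤ) :=
  {j | j.1 + j.2.1 + j.2.2 = 0 ∧ -(n : ℤ) ≤ j.1 ∧ j.1 ≤ n ∧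
       -(n : ℤ) ≤ j.2.1 ∧ j.2.1 ≤ n ∧ -(n : ℤ) ≤ j.2.2 ∧ j.2.2 ≤ n}

/-- `ℍ_n° = {j ∈ ℍ : -n < j₁, j₂, j₃ < n}`. -/
def Hcirc (n : ℕ) : Set (ℤ × ℤ × ℤ) :=
  {j | j.1 + j.2.1 + j.2.2 = 0 ∧ -(n : ℤ) < j.1 ∧ j.1 < n ∧
       -(n : ℤ) < j.2.1 ∧ j.2.1 < n ∧ -(n : ℤ) < j.2.2 ∧ j.2.2 < n}

/-- The weights `c_j^{(n)}`: 1 on interior points, 1/2 on edge points, 1/3 on vertices. -/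
def cwt (n : ℕ) (j : ℤ × ℤ × ℤ) : ℝ :=
  if -(n : ℤ) < j.1 ∧ j.1 < n ∧ -(n : ℤ) < j.2.1 ∧ j.2.1 < n ∧
      -(n : ℤ) < j.2.2 ∧ j.2.2 < n then 1
  else if j.1 * j.2.1 * j.2.2 ≠ 0 then 1 / 2 else 1 / 3

/-- The point `j/n = (j₁/n, j₂/n, j₃/n)`. -/
def pt (n : ℕ) (j : ℤ × ℤ × ℤ) : ℝ × ℝ × ℝ :=
  ((j.1 : ℝ) / n, (j.2.1 : ℝ) / n, (j.2.2 : ℝ) / n)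

/-- Homogeneous coordinates `t(x) = (-x₂/2 + √3 x₁/2, x₂, -x₂/2 - √3 x₁/2)`. -/
def Tmap (x : ℝ × ℝ) : ℝ × ℝ × ℝ :=
  (-x.2 / 2 + Real.sqrt 3 * x.1 / 2, x.2, -x.2 / 2 - Real.sqrt 3 * x.1 / 2)

/-- The planar hexagon `Ω_H` (of area 2√3). -/
def OmegaH : Set (ℝ × ℝ) :=
  {x | -1 ≤ (Tmap x).1 ∧ (Tmap x).1 < 1 ∧ -1 ≤ (Tmap x).2.1 ∧ (Tmap x).2.1 < 1 ∧
       -1 ≤ -(Tmap x).2.2 ∧ -(Tmap x).2.2 < 1}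

/-- `⟨f,g⟩_H = (1/(2√3)) ∫_{Ω_H} f(t(x)) conj(g(t(x))) dx`. -/
def innerH (f g : ℝ × ℝ × ℝ → ℂ) : ℂ :=
  ((1 / (2 * Real.sqrt 3) : ℝ) : ℂ) *
    ∫ x in OmegaH, f (Tmap x) * (starRingEnd ℂ) (g (Tmap x))

/-- `t ≡ s (mod 3)`: the differences `tᵢ - sᵢ` are pairwise congruent modulo `3ℤ`. -/
def congMod3 (t s : ℝ × ℝ × ℝ) : Prop :=
  (∃ m : ℤ, (t.1 - s.1) - (t.2.1 - s.2.1) = 3 * m) ∧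
  (∃ m : ℤ, (t.2.1 - s.2.1) - (t.2.2 - s.2.2) = 3 * m)

/-- `Φ_n*(t) = (1/(3n²)) Σ_{j ∈ ℍ_n*} c_j^{(n)} φ_j(t)`. -/
def PhiStar (n : ℕ) (t : ℝ × ℝ × ℝ) : ℂ :=
  ((1 / (3 * (n : ℝ) ^ 2) : ℝ) : ℂ) * ∑ᶠ j ∈ Hstar n, ((cwt n j : ℝ) : ℂ) * phi j t

open Finset in
/-- The pairs `(j₁, j₂)` of coordinates of the points of `ℍ_n*`. -/
def hexPairs (n : ℕ) : Finset (ℤ × ℤ) :=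
  {p ∈ Icc (-(n : ℤ)) n ×ˢ Icc (-(n : ℤ)) n | -(n : ℤ) ≤ p.1 + p.2 ∧ p.1 + p.2 ≤ n}

/-- A rectangle representing `ℤ²` modulo the lattice generated by `(2n, -n)` and `(-n, 2n)`. -/
def rectPairs (n : ℕ) : Finset (ℤ × ℤ) :=
  Finset.Ico (-(n : ℤ)) (2 * n) ×ˢ Finset.Ico (0 : ℤ) n

/-- The representative in `rectPairs n` of a point of `hexPairs n`. -/
def hexFold (n : ℕ) (p : ℤ × ℤ) : ℤ × ℤ :=
  if p.2 < 0 then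
    if p.1 < n then (p.1 + n, p.2 + n) else (p.1 - 2 * n, p.2 + n)
  else if p.2 < n then p
  else if p.1 < 0 then (p.1 + 2 * n, p.2 - n) else (p.1 - n, p.2 - n)

/-- The weight of a point of `hexPairs n`. -/
def hexWeight (n : ℕ) (p : ℤ × ℤ) : ℂ :=
  ((cwt n (p.1, p.2, -p.1 - p.2) : ℝ) : ℂ)

lemma mem_hexPairs {n : ℕ} {x y : ℤ} :
    (x, y) ∈ hexPairs n ↔ -(n : ℤ) ≤ x ∧ x ≤ n ∧ -(n : ℤ) ≤ y ∧ y ≤ n ∧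
      -(n : ℤ) ≤ x + y ∧ x + y ≤ n := by
  simp [hexPairs, and_assoc]

lemma mem_rectPairs {n : ℕ} {x y : ℤ} :
    (x, y) ∈ rectPairs n ↔ -(n : ℤ) ≤ x ∧ x < 2 * n ∧ 0 ≤ y ∧ y < n := by
  simp [rectPairs, and_assoc]

lemma hexFold_mem {n : ℕ} (hn : 1 ≤ n) {p : ℤ × ℤ} (hp : p ∈ hexPairs n) :
    hexFold n p ∈ rectPairs n := by
  obtain ⟨x, y⟩ := p
  rw [mem_hexPairs] at hp
  unfold hexFold
  dsimp only
  split_ifs <;> rw [mem_rectPairs] <;> omega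

lemma hexWeight_interior {n : ℕ} {x y : ℤ} (h : -(n : ℤ) < x ∧ x < n ∧ -(n : ℤ) < y ∧ y < n ∧
    -(n : ℤ) < x + y ∧ x + y < n) : hexWeight n (x, y) = 1 := by
  have h' : -(n : ℤ) < x ∧ x < n ∧ -(n : ℤ) < y ∧ y < n ∧ -(n : ℤ) < -x - y ∧ -x - y < n := by
    omega
  simp only [hexWeight, cwt, if_pos h', Complex.ofReal_one]

lemma hexWeight_edge {n : ℕ} {x y : ℤ}
    (h : ¬ (-(n : ℤ) < x ∧ x < n ∧ -(n : ℤ) < y ∧ y < n ∧ -(n : ℤ) < x + y ∧ x + y < n))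
    (hx : x ≠ 0) (hy : y ≠ 0) (hxy : x + y ≠ 0) : hexWeight n (x, y) = 1 / 2 := by
  have h' : ¬ (-(n : ℤ) < x ∧ x < n ∧ -(n : ℤ) < y ∧ y < n ∧ -(n : ℤ) < -x - y ∧ -x - y < n) := by
    omega
  have h0 : x * y * (-x - y) ≠ 0 := mul_ne_zero (mul_ne_zero hx hy) (by omega)
  simp only [hexWeight, cwt, if_neg h', if_pos h0]
  norm_num

lemma hexWeight_vertex {n : ℕ} {x y : ℤ}
    (h : ¬ (-(n : ℤ) < x ∧ x < n ∧ -(n : ℤ) < y ∧ y < n ∧ -(n : ℤ) < x + y ∧ x + y < n))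
    (h0 : x = 0 ∨ y = 0 ∨ x + y = 0) : hexWeight n (x, y) = 1 / 3 := by
  have h' : ¬ (-(n : ℤ) < x ∧ x < n ∧ -(n : ℤ) < y ∧ y < n ∧ -(n : ℤ) < -x - y ∧ -x - y < n) := by
    omega
  have h1 : ¬ x * y * (-x - y) ≠ 0 := by
    rcases h0 with h0 | h0 | h0
    · simp [h0]
    · simp [h0]
    · simp [show -x - y = 0 by omega]
  simp only [hexWeight, cwt, if_neg h', if_neg h1]
  norm_num

/-- The weights of the points of the hexagon in a given class modulo the lattice add up to `1`. -/
lemma sum_hexWeight_fiber {n : ℕ} (hn : 1 ≤ n) {r : ℤ × ℤ} (hr : r ∈ rectPairs n) :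
    ∑ p ∈ hexPairs n with hexFold n p = r, hexWeight n p = 1 := by
  obtain ⟨x, y⟩ := r
  rw [mem_rectPairs] at hr
  have hfib : (hexPairs n).filter (fun p => hexFold n p = (x, y)) =
      ({(x, y), (x - n, y - n), (x + 2 * n, y - n), (x - 2 * n, y + n), (x + n, y + n)} :
        Finset (ℤ × ℤ)).filter (fun p => p ∈ hexPairs n) := by
    ext ⟨u, v⟩
    rw [Finset.mem_filter, Finset.mem_filter]
    simp only [mem_hexPairs, Finset.mem_insert, Finset.mem_singleton,
      Prod.mk.injEq, hexFold]
    constructor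
    · rintro ⟨h, hf⟩
      split_ifs at hf <;> rw [Prod.mk.injEq] at hf <;> omega
    · rintro ⟨h, hf⟩
      split_ifs <;> rw [Prod.mk.injEq] <;> omega
  rw [hfib, Finset.sum_filter, Finset.sum_insert, Finset.sum_insert, Finset.sum_insert,
    Finset.sum_insert, Finset.sum_singleton]
  rotate_left
  iterate 4
    simp only [Finset.mem_insert, Finset.mem_singleton, Prod.mk.injEq]
    omega
  simp only [mem_hexPairs]
  have hcases : (-(n : ℤ) < x ∧ x + y < n) ∨ (n < x + y ∧ 0 < y) ∨ (x = -n ∧ 0 < y) ∨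
      (x + y = n ∧ 0 < y) ∨ (y = 0 ∧ n < x) ∨ (x = -n ∧ y = 0) ∨ (x = n ∧ y = 0) := by
    omega
  rcases hcases with h | h | h | h | h | h | h
  · rw [if_pos (by omega), if_neg (by omega), if_neg (by omega), if_neg (by omega),
      if_neg (by omega), hexWeight_interior (by omega)]
    norm_num
  · rw [if_neg (by omega), if_pos (by omega), if_neg (by omega), if_neg (by omega),
      if_neg (by omega), hexWeight_interior (by omega)]
    norm_num
  · rw [if_pos (by omega), if_neg (by omega), if_pos (by omega), if_neg (by omega),
      if_neg (by omega), hexWeight_edge (by omega) (by omega) (by omega) (by omega),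
      hexWeight_edge (by omega) (by omega) (by omega) (by omega)]
    norm_num
  · rw [if_pos (by omega), if_pos (by omega), if_neg (by omega), if_neg (by omega),
      if_neg (by omega), hexWeight_edge (by omega) (by omega) (by omega) (by omega),
      hexWeight_edge (by omega) (by omega) (by omega) (by omega)]
    norm_num
  · rw [if_neg (by omega), if_pos (by omega), if_neg (by omega), if_pos (by omega),
      if_neg (by omega), hexWeight_edge (by omega) (by omega) (by omega) (by omega),
      hexWeight_edge (by omega) (by omega) (by omega) (by omega)]
    norm_num
  · rw [if_pos (by omega), if_neg (by omega), if_pos (by omega), if_neg (by omega),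
      if_pos (by omega), hexWeight_vertex (by omega) (by omega),
      hexWeight_vertex (by omega) (by omega), hexWeight_vertex (by omega) (by omega)]
    norm_num
  · rw [if_pos (by omega), if_pos (by omega), if_neg (by omega), if_pos (by omega),
      if_neg (by omega), hexWeight_vertex (by omega) (by omega),
      hexWeight_vertex (by omega) (by omega), hexWeight_vertex (by omega) (by omega)]
    norm_num

/-- The weighted sum over the hexagon of a function invariant under `hexFold` is its sum over
the rectangle. -/
lemma sum_hexWeight_mul {n : ℕ} (hn : 1 ≤ n) {G : ℤ × ℤ → ℂ} (hG : ∀ p, G (hexFold n p) = G p) :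
    ∑ p ∈ hexPairs n, hexWeight n p * G p = ∑ r ∈ rectPairs n, G r := by
  rw [← Finset.sum_fiberwise_of_maps_to (fun p hp => hexFold_mem hn hp)]
  refine Finset.sum_congr rfl fun r hr => ?_
  calc ∑ p ∈ hexPairs n with hexFold n p = r, hexWeight n p * G p
      = ∑ p ∈ hexPairs n with hexFold n p = r, hexWeight n p * G r := by
        refine Finset.sum_congr rfl fun p hp => ?_
        rw [← (Finset.mem_filter.1 hp).2, hG]
    _ = G r := by rw [← Finset.sum_mul, sum_hexWeight_fiber hn hr, one_mul]

lemma zpow_mul_zpow_hexFold {n : ℕ} {z w : ℂ} (hz : z ≠ 0) (hw : w ≠ 0) (hz3 : z ^ (3 * n) = 1)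
    (hzw : z ^ n * w ^ n = 1) (p : ℤ × ℤ) :
    z ^ (hexFold n p).1 * w ^ (hexFold n p).2 = z ^ p.1 * w ^ p.2 := by
  obtain ⟨x, y⟩ := p
  have hzn : z ^ n ≠ 0 := pow_ne_zero _ hz
  have hw' : w ^ n = (z ^ n)⁻¹ := eq_inv_of_mul_eq_one_right hzw
  have hz3' : (z ^ n) ^ 3 = 1 := by rw [← pow_mul, mul_comm, hz3]
  have hz2 : z ^ (2 * (n : ℤ)) = (z ^ n) ^ 2 := by
    rw [mul_comm, zpow_mul, zpow_natCast]; rfl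
  unfold hexFold
  dsimp only
  split_ifs <;> simp only [zpow_add₀ hz, zpow_add₀ hw, zpow_sub₀ hz, zpow_sub₀ hw, hz2,
    zpow_natCast, hw'] <;> field_simp <;> simp only [hz3']

lemma sum_Ico_zpow_eq_zero {z : ℂ} (hz : z ≠ 0) (hz1 : z ≠ 1) (a : ℤ) {m : ℕ} (hm : z ^ m = 1) :
    ∑ x ∈ Finset.Ico a (a + m), z ^ x = 0 := by
  have h : ∑ x ∈ Finset.Ico a (a + m), z ^ x = ∑ i ∈ Finset.range m, z ^ a * z ^ i := by
    symm
    refine Finset.sum_bij (fun i _ => a + (i : ℤ)) ?_ ?_ ?_ ?_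
    · intro i hi
      rw [Finset.mem_range] at hi
      rw [Finset.mem_Ico]
      omega
    · intro i _ k _ hik
      omega
    · intro x hx
      rw [Finset.mem_Ico] at hx
      exact ⟨(x - a).toNat, by rw [Finset.mem_range]; omega, by omega⟩
    · intro i _
      rw [zpow_add₀ hz, zpow_natCast]
  rw [h, ← Finset.mul_sum, geom_sum_eq hz1, hm, sub_self, zero_div, mul_zero]

/-- Discrete orthogonality on the rectangle. -/
lemma sum_rectPairs {n : ℕ} {z w : ℂ} (hz : z ≠ 0) (hw : w ≠ 0)
    (hz3 : z ^ (3 * n) = 1) (hzw : z ^ n * w ^ n = 1) :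
    ∑ r ∈ rectPairs n, z ^ r.1 * w ^ r.2 = if z = 1 ∧ w = 1 then 3 * (n : ℂ) ^ 2 else 0 := by
  rw [rectPairs, Finset.sum_product]
  dsimp only
  rw [← Finset.sum_mul_sum]
  by_cases h1 : z = 1
  · subst h1
    by_cases h2 : w = 1
    · subst h2
      have e : ((2 * (n : ℤ) + n).toNat : ℂ) = 3 * n := by
        rw [show (2 * (n : ℤ) + n).toNat = 3 * n by omega]
        push_cast
        rfl
      simp [e]
      ring
    · rw [if_neg (fun h => h2 h.2)]
      have := sum_Ico_zpow_eq_zero hw h2 0 (m := n) (by simpa using hzw)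
      rw [zero_add] at this
      rw [this, mul_zero]
  · rw [if_neg (fun h => h1 h.1)]
    have := sum_Ico_zpow_eq_zero hz h1 (-n) hz3
    rw [show -(n : ℤ) + ((3 * n : ℕ) : ℤ) = 2 * n by push_cast; ring] at this
    rw [this, zero_mul]

lemma finsum_mem_Hstar (n : ℕ) (F : ℤ × ℤ × ℤ → ℂ) :
    ∑ᶠ j ∈ Hstar n, F j = ∑ p ∈ hexPairs n, F (p.1, p.2, -p.1 - p.2) := by
  rw [← finsum_mem_coe_finset]
  symm
  refine finsum_mem_eq_of_bijOn (fun p : ℤ × ℤ => (p.1, p.2, -p.1 - p.2)) ⟨?_, ?_, ?_⟩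
    fun _ _ => rfl
  · rintro ⟨x, y⟩ h
    rw [Finset.mem_coe, mem_hexPairs] at h
    simp only [Hstar, Set.mem_ofPred_eq]
    omega
  · rintro ⟨x, y⟩ _ ⟨u, v⟩ _ h
    simp only [Prod.mk.injEq] at h ⊢
    exact ⟨h.1, h.2.1⟩
  · rintro ⟨x, y, t⟩ h
    simp only [Hstar, Set.mem_ofPred_eq] at h
    refine ⟨(x, y), ?_, ?_⟩
    · rw [Finset.mem_coe, mem_hexPairs]
      omega
    · simp only [Prod.mk.injEq, true_and]
      omega

lemma congMod3_pt_iff {n : ℕ} (hn : 1 ≤ n) (k j : ℤ × ℤ × ℤ) :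
    congMod3 (pt n k) (pt n j) ↔
      (∃ m : ℤ, (k.1 - j.1) - (k.2.1 - j.2.1) = 3 * n * m) ∧
      (∃ m : ℤ, (k.2.1 - j.2.1) - (k.2.2 - j.2.2) = 3 * n * m) := by
  have hn0 : (n : ℝ) ≠ 0 := by positivity
  have key : ∀ (a b c d m : ℤ), ((a : ℝ) / n - b / n - (c / n - d / n) = 3 * m) ↔
      (a - b) - (c - d) = 3 * n * m := by
    intro a b c d m
    rw [← @Int.cast_inj ℝ]
    push_cast
    constructor <;> intro h
    · field_simp at h
      linarith
    · field_simp
      linarith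
  simp only [congMod3, pt, key]

lemma exp_two_pi_div_eq_one_iff {n : ℕ} (hn : 1 ≤ n) (a : ℤ) :
    Complex.exp (2 * (Real.pi : ℂ) * Complex.I * a / (3 * n)) = 1 ↔ ∃ m : ℤ, a = 3 * n * m := by
  have hn0 : (n : ℂ) ≠ 0 := by
    rw [Nat.cast_ne_zero]
    omega
  rw [Complex.exp_eq_one_iff]
  refine exists_congr fun m => ?_
  rw [← @Int.cast_inj ℂ]
  push_cast
  constructor <;> intro h
  · have h2 : (2 * (Real.pi : ℂ) * Complex.I) * a = (2 * Real.pi * Complex.I) * (3 * n * m) := by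
      field_simp at h ⊢
      linear_combination h
    exact mul_left_cancel₀ Complex.two_pi_I_ne_zero h2
  · rw [h]
    field_simp

/-- The values of `PhiStar` at the lattice points. -/
lemma PhiStar_pt_sub {n : ℕ} (hn : 1 ≤ n) {k j : ℤ × ℤ × ℤ} (hk : k ∈ Hstar n)
    (hj : j ∈ Hstar n) :
    PhiStar n (pt n k - pt n j) = if congMod3 (pt n k) (pt n j) then 1 else 0 := by
  have hn0 : (n : ℂ) ≠ 0 := by
    rw [Nat.cast_ne_zero]
    omega
  obtain ⟨k₁, k₂, k₃⟩ := k
  obtain ⟨j₁, j₂, j₃⟩ := j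
  have hk0 : k₁ + k₂ + k₃ = 0 := hk.1
  have hj0 : j₁ + j₂ + j₃ = 0 := hj.1
  obtain rfl : k₃ = -k₁ - k₂ := by omega
  obtain rfl : j₃ = -j₁ - j₂ := by omega
  set a : ℤ := 2 * (k₁ - j₁) + (k₂ - j₂) with ha
  set b : ℤ := (k₁ - j₁) + 2 * (k₂ - j₂) with hb
  set z : ℂ := Complex.exp (2 * (Real.pi : ℂ) * Complex.I * a / (3 * n)) with hz
  set w : ℂ := Complex.exp (2 * (Real.pi : ℂ) * Complex.I * b / (3 * n)) with hw
  have hz3 : z ^ (3 * n) = 1 := by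
    rw [hz, ← Complex.exp_nat_mul, Complex.exp_eq_one_iff]
    refine ⟨a, ?_⟩
    push_cast
    field_simp
  have hzw : z ^ n * w ^ n = 1 := by
    rw [hz, hw, ← Complex.exp_nat_mul, ← Complex.exp_nat_mul, ← Complex.exp_add,
      Complex.exp_eq_one_iff]
    refine ⟨(k₁ - j₁) + (k₂ - j₂), ?_⟩
    rw [ha, hb]
    push_cast
    field_simp
    ring
  have hphi : ∀ p : ℤ × ℤ, phi (p.1, p.2, -p.1 - p.2)
      (pt n (k₁, k₂, -k₁ - k₂) - pt n (j₁, j₂, -j₁ - j₂)) = z ^ p.1 * w ^ p.2 := by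
    intro p
    rw [hz, hw, ← Complex.exp_int_mul, ← Complex.exp_int_mul, ← Complex.exp_add, phi]
    congr 1
    rw [ha, hb]
    simp only [pt, Prod.fst_sub, Prod.snd_sub]
    push_cast
    field_simp
    ring
  have hz0 : z ≠ 0 := Complex.exp_ne_zero _
  have hw0 : w ≠ 0 := Complex.exp_ne_zero _
  have hsum := sum_hexWeight_mul hn (G := fun p => z ^ p.1 * w ^ p.2)
    (zpow_mul_zpow_hexFold hz0 hw0 hz3 hzw)
  rw [sum_rectPairs hz0 hw0 hz3 hzw] at hsum
  rw [PhiStar, finsum_mem_Hstar]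
  simp only [hphi]
  simp only [hexWeight] at hsum
  rw [hsum]
  have hiff : (z = 1 ∧ w = 1) ↔ congMod3 (pt n (k₁, k₂, -k₁ - k₂)) (pt n (j₁, j₂, -j₁ - j₂)) := by
    rw [hz, hw, exp_two_pi_div_eq_one_iff hn, exp_two_pi_div_eq_one_iff hn, congMod3_pt_iff hn]
    constructor
    · rintro ⟨⟨m, hm⟩, ⟨l, hl⟩⟩
      exact ⟨⟨m - l, by linear_combination hm - hl⟩, ⟨l, by linear_combination hl⟩⟩
    · rintro ⟨⟨m, hm⟩, ⟨l, hl⟩⟩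
      exact ⟨⟨m + l, by linear_combination hm + hl⟩, ⟨l, by linear_combination hl⟩⟩
  simp only [hiff]
  split_ifs
  · push_cast
    field_simp
  · rw [mul_zero]

lemma congMod3_comm {t s : ℝ × ℝ × ℝ} : congMod3 t s ↔ congMod3 s t := by
  have key : ∀ t s : ℝ × ℝ × ℝ, congMod3 t s → congMod3 s t := by
    rintro t s ⟨⟨m, hm⟩, ⟨l, hl⟩⟩
    refine ⟨⟨-m, ?_⟩, ⟨-l, ?_⟩⟩ <;> push_cast <;> linarith
  exact ⟨key t s, key s t⟩

lemma eq_of_congMod3_of_mem_Hcirc {n : ℕ} (hn : 1 ≤ n) {k j : ℤ × ℤ × ℤ} (hk : k ∈ Hstar n)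
    (hj : j ∈ Hcirc n) (h : congMod3 (pt n k) (pt n j)) : k = j := by
  rw [congMod3_pt_iff hn] at h
  obtain ⟨⟨m, hm⟩, ⟨l, hl⟩⟩ := h
  obtain ⟨k₁, k₂, k₃⟩ := k
  obtain ⟨j₁, j₂, j₃⟩ := j
  simp only [Hstar, Hcirc, Set.mem_ofPred_eq] at hk hj hm hl
  have hn' : (0 : ℤ) < n := by omega
  have h1 : k₁ - j₁ = n * (2 * m + l) := by linarith
  have h2 : k₂ - j₂ = n * (l - m) := by linarith
  have h3 : k₃ - j₃ = n * (-m - 2 * l) := by linarith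
  have bound : ∀ p : ℤ, -(2 * (n : ℤ)) < n * p → n * p < 2 * n → -2 < p ∧ p < 2 := by
    intro p hp hp'
    constructor <;> nlinarith
  have b1 := bound _ (by omega) (by omega : (n : ℤ) * (2 * m + l) < 2 * n)
  have b2 := bound _ (by omega) (by omega : (n : ℤ) * (l - m) < 2 * n)
  have b3 := bound _ (by omega) (by omega : (n : ℤ) * (-m - 2 * l) < 2 * n)
  obtain rfl : m = 0 := by omega
  obtain rfl : l = 0 := by omega
  simp only [Prod.mk.injEq]
  norm_num at h1 h2 h3
  omega

/-- The interpolant at a lattice point sums the values at the congruent nodes. -/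
lemma finsum_mul_PhiStar {n : ℕ} (hn : 1 ≤ n) (f : ℝ × ℝ × ℝ → ℂ) {j : ℤ × ℤ × ℤ}
    (hj : j ∈ Hstar n) :
    (∑ᶠ l ∈ Hstar n, f (pt n l) * PhiStar n (pt n j - pt n l)) =
      ∑ᶠ k ∈ {k ∈ Hstar n | congMod3 (pt n k) (pt n j)}, f (pt n k) := by
  refine finsum_congr fun l => ?_
  by_cases hl : l ∈ Hstar n
  · simp only [hl, Set.mem_ofPred_eq, true_and, finsum_true, PhiStar_pt_sub hn hj hl,
      congMod3_comm (t := pt n j)]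
    by_cases h : congMod3 (pt n l) (pt n j) <;> simp [h]
  · simp [hl]

theorem stmt_6 (n : ℕ) (hn : 1 ≤ n) :
    (∀ k ∈ Hstar n, ∀ j ∈ Hstar n,
      PhiStar n (pt n k - pt n j) =
        if congMod3 (pt n k) (pt n j) then 1 else 0) ∧
    (∀ f : ℝ × ℝ × ℝ → ℂ,
      (∀ j ∈ Hcirc n,
        (∑ᶠ l ∈ Hstar n, f (pt n l) * PhiStar n (pt n j - pt n l)) = f (pt n j)) ∧
      (∀ j ∈ Hstar n \ Hcirc n,
        (∑ᶠ l ∈ Hstar n, f (pt n l) * PhiStar n (pt n j - pt n l)) =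
          ∑ᶠ k ∈ {k ∈ Hstar n | congMod3 (pt n k) (pt n j)}, f (pt n k))) := by
  refine ⟨fun k hk j hj => PhiStar_pt_sub hn hk hj, fun f => ⟨fun j hj => ?_, fun j hj =>
    finsum_mul_PhiStar hn f hj.1⟩⟩
  have hj' : j ∈ Hstar n := by
    simp only [Hstar, Hcirc, Set.mem_ofPred_eq] at hj ⊢
    omega
  have hset : {k ∈ Hstar n | congMod3 (pt n k) (pt n j)} = {j} := by
    ext k
    simp only [Set.mem_ofPred_eq, Set.mem_singleton_iff]
    constructor
    · rintro ⟨hk, h⟩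
      exact eq_of_congMod3_of_mem_Hcirc hn hk hj h
    · rintro rfl
      exact ⟨hj', ⟨0, by simp⟩, ⟨0, by simp⟩⟩
  rw [finsum_mul_PhiStar hn f hj', hset, finsum_mem_singleton]
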